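/- Let $(X_1, C_1, u_1)$ and $(X_2, C_2, u_2)$ be order unit spaces with strictly positive states $\varphi_1, \varphi_2$ and cross sections $\Sigma_i = \{x \in C_i^\circ : \varphi_i(x) = 1\}$. Let $f : (\Sigma_1, d_H) \to (\Sigma_2, d_H)$ be an isometry that maps line segments to line segments, and let $Y \subseteq X_1$ be a linear subspace with $Y \cap \Sigma_1 \neq \emptyset$. If $T : Y \to X_2$ is a bi-positive linear map (with respect to $C_1 \cap Y$ and $C_2$) such that $Ty / \varphi_2(Ty) = f(y)$ for all $y \in Y \cap \Sigma_1$, then for every $z \in \Sigma_1 \setminus Y$ there exists a bi-positive linear extension $\hat{T} : Y \oplus \mathrm{Span}\{z\} \to X_2$ of $T$ such that $\hat{T}y / \varphi_2(\hat{T}y) = f(y)$ for all $y \in (Y \oplus \mathrm{Span}\{z\}) \cap \Sigma_1$. -/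

import Mathlib

namespace HilbertGeom

/-- An order unit space: a real vector space with an Archimedean cone `C` and order unit `u`. -/
structure OrderUnitSpace (X : Type*) [AddCommGroup X] [Module ℝ X] where
  C : Set X
  u : X
  convex : Convex ℝ C
  smul_mem : ∀ ⦃c : ℝ⦄, 0 ≤ c → ∀ ⦃x : X⦄, x ∈ C → c • x ∈ C
  salient : ∀ ⦃x : X⦄, x ∈ C → -x ∈ C → x = 0
  archimedean : ∀ x y : X, y ∈ C → (∀ n : ℕ, 0 < n → y - (n : ℝ) • x ∈ C) → -x ∈ C
  u_mem : u ∈ C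
  orderUnit : ∀ x : X, ∃ c : ℝ, 0 < c ∧ c • u - x ∈ C

namespace OrderUnitSpace

variable {X : Type*} [AddCommGroup X] [Module ℝ X] (S : OrderUnitSpace X)

/-- The order unit norm `‖x‖_u = inf {c > 0 : -c•u ≤ x ≤ c•u}`. -/
noncomputable def onorm (x : X) : ℝ :=
  sInf {c : ℝ | 0 < c ∧ c • S.u - x ∈ S.C ∧ c • S.u + x ∈ S.C}

/-- The interior of the cone `C` with respect to the order unit norm. -/
def interiorC : Set X :=
  {x : X | ∃ ε > 0, ∀ y : X, S.onorm (y - x) < ε → y ∈ S.C}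

/-- `M(x/y) = inf {β > 0 : x ≤_C β y}`. -/
noncomputable def M (x y : X) : ℝ := sInf {c : ℝ | 0 < c ∧ c • y - x ∈ S.C}

/-- Birkhoff's version of Hilbert's metric. -/
noncomputable def dH (x y : X) : ℝ := Real.log (S.M x y * S.M y x)

/-- `φ` is a state: a linear functional with `φ u = 1`. -/
def IsState (φ : X →ₗ[ℝ] ℝ) : Prop := φ S.u = 1

/-- `φ` is strictly positive: `φ(C \ {0}) ⊆ (0, ∞)`. -/
def StrictlyPos (φ : X →ₗ[ℝ] ℝ) : Prop := ∀ x ∈ S.C, x ≠ 0 → 0 < φ x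

/-- The cross section `Σ_φ = {x ∈ C° : φ x = 1}`. -/
def Sig (φ : X →ₗ[ℝ] ℝ) : Set X := {x | x ∈ S.interiorC ∧ φ x = 1}

/-- `z` lies in the closure of `A` with respect to the order unit norm. -/
def InClosure (A : Set X) (z : X) : Prop := ∀ ε > 0, ∃ w ∈ A, S.onorm (w - z) < ε

/-- The relative boundary of `Σ_φ` (in the affine hyperplane `φ = 1`, w.r.t. the order
unit norm): since `Σ_φ` is relatively open this is its closure minus itself. -/
def relBoundary (φ : X →ₗ[ℝ] ℝ) : Set X :=
  {z : X | S.InClosure (S.Sig φ) z ∧ z ∉ S.Sig φ}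

/-- The straight line through `x` and `y`. -/
def lineThrough (x y : X) : Set X := {z : X | ∃ t : ℝ, z = x + t • (y - x)}

end OrderUnitSpace

end HilbertGeom

namespace HilbertGeom

open OrderUnitSpace

namespace OrderUnitSpace

variable {X : Type*} [AddCommGroup X] [Module ℝ X] (S : OrderUnitSpace X)

theorem add_mem {x y : X} (hx : x ∈ S.C) (hy : y ∈ S.C) : x + y ∈ S.C := by
  have h := S.convex hx hy (a := 1 / 2) (b := 1 / 2) (by norm_num) (by norm_num) (by norm_num)
  have h2 := S.smul_mem (c := 2) (by norm_num) h
  convert h2 using 1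
  module

theorem zero_mem : (0 : X) ∈ S.C := by
  simpa using S.smul_mem le_rfl S.u_mem

theorem mem_of_forall_nat_smul_add {w v : X} (hv : v ∈ S.C)
    (h : ∀ n : ℕ, 0 < n → v + (n : ℝ) • w ∈ S.C) : w ∈ S.C := by
  have := S.archimedean (-w) v hv (fun n hn => by simpa using h n hn)
  simpa using this

theorem smul_mem_iff {c : ℝ} (hc : 0 < c) {x : X} : c • x ∈ S.C ↔ x ∈ S.C := by
  refine ⟨fun h => ?_, fun h => S.smul_mem hc.le h⟩
  have := S.smul_mem (inv_nonneg.2 hc.le) h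
  rwa [smul_smul, inv_mul_cancel₀ hc.ne', one_smul] at this

theorem mem_interiorC_iff_exists_sub_unit {x : X} :
    x ∈ S.interiorC ↔ ∃ ε : ℝ, 0 < ε ∧ x - ε • S.u ∈ S.C := by
  constructor
  · rintro ⟨ε, hε, h⟩
    refine ⟨ε / 2, by positivity, h _ ?_⟩
    refine lt_of_le_of_lt (csInf_le ⟨0, fun c hc => hc.1.le⟩ ⟨half_pos hε, ?_, ?_⟩)
      (half_lt_self hε)
    · have := S.smul_mem hε.le S.u_mem
      convert this using 1
      module
    · convert S.zero_mem using 1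
      module
  · rintro ⟨ε, hε, h⟩
    refine ⟨ε, hε, fun y hy => ?_⟩
    have hne : {c : ℝ | 0 < c ∧ c • S.u - (y - x) ∈ S.C ∧ c • S.u + (y - x) ∈ S.C}.Nonempty := by
      obtain ⟨c, hc, h1⟩ := S.orderUnit (y - x)
      obtain ⟨d, hd, h2⟩ := S.orderUnit (-(y - x))
      refine ⟨c + d, by positivity, ?_, ?_⟩
      · convert S.add_mem h1 (S.smul_mem hd.le S.u_mem) using 1
        module
      · convert S.add_mem h2 (S.smul_mem hc.le S.u_mem) using 1
        module
    obtain ⟨c, ⟨-, -, hc⟩, hlt⟩ := exists_lt_of_csInf_lt hne hy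
    convert S.add_mem (S.add_mem h hc) (S.smul_mem (sub_nonneg.2 hlt.le) S.u_mem) using 1
    module

theorem mem_of_mem_interiorC {x : X} (hx : x ∈ S.interiorC) : x ∈ S.C := by
  obtain ⟨ε, hε, h⟩ := S.mem_interiorC_iff_exists_sub_unit.1 hx
  convert S.add_mem h (S.smul_mem hε.le S.u_mem) using 1
  module

theorem exists_sub_smul_mem {x : X} (hx : x ∈ S.interiorC) (v : X) :
    ∃ δ : ℝ, 0 < δ ∧ x - δ • v ∈ S.C := by
  obtain ⟨ε, hε, h⟩ := S.mem_interiorC_iff_exists_sub_unit.1 hx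
  obtain ⟨c, hc, h1⟩ := S.orderUnit v
  refine ⟨ε / c, by positivity, ?_⟩
  convert S.add_mem h (S.smul_mem (div_pos hε hc).le h1) using 1
  rw [smul_sub, smul_smul, div_mul_cancel₀ _ hc.ne']
  module

theorem add_mem_interiorC {x y : X} (hx : x ∈ S.interiorC) (hy : y ∈ S.C) :
    x + y ∈ S.interiorC := by
  obtain ⟨ε, hε, h⟩ := S.mem_interiorC_iff_exists_sub_unit.1 hx
  refine S.mem_interiorC_iff_exists_sub_unit.2 ⟨ε, hε, ?_⟩
  convert S.add_mem h hy using 1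
  module

theorem smul_mem_interiorC {x : X} (hx : x ∈ S.interiorC) {c : ℝ} (hc : 0 < c) :
    c • x ∈ S.interiorC := by
  obtain ⟨ε, hε, h⟩ := S.mem_interiorC_iff_exists_sub_unit.1 hx
  refine S.mem_interiorC_iff_exists_sub_unit.2 ⟨c * ε, by positivity, ?_⟩
  convert S.smul_mem hc.le h using 1
  module

theorem exists_smul_add_mem_interiorC {x : X} (hx : x ∈ S.interiorC) (v : X) :
    ∃ N : ℝ, 0 < N ∧ ∀ N' ≥ N, N' • x + v ∈ S.interiorC := by
  obtain ⟨δ, hδ, h⟩ := S.exists_sub_smul_mem hx (-v)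
  refine ⟨δ⁻¹ + 1, by positivity, fun N' hN' => ?_⟩
  have h1 := S.smul_mem (inv_nonneg.2 hδ.le) h
  convert S.add_mem_interiorC (S.smul_mem_interiorC hx (c := N' - δ⁻¹) (by linarith)) h1 using 1
  rw [smul_sub, smul_smul, inv_mul_cancel₀ hδ.ne']
  module

variable {S} {φ : X →ₗ[ℝ] ℝ}

theorem zero_notMem_interiorC (hφ : S.IsState φ) : (0 : X) ∉ S.interiorC := by
  intro h
  obtain ⟨ε, hε, h⟩ := S.mem_interiorC_iff_exists_sub_unit.1 h
  have h1 : -S.u ∈ S.C := by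
    rw [← S.smul_mem_iff hε]
    simpa using h
  have := S.salient S.u_mem h1
  simp [IsState, this] at hφ

theorem StrictlyPos.pos_of_mem_interiorC (hpos : S.StrictlyPos φ) (hφ : S.IsState φ) {x : X}
    (hx : x ∈ S.interiorC) : 0 < φ x :=
  hpos x (S.mem_of_mem_interiorC hx) fun h => zero_notMem_interiorC hφ (h ▸ hx)

theorem StrictlyPos.normalize_mem_Sig (hpos : S.StrictlyPos φ) (hφ : S.IsState φ) {x : X}
    (hx : x ∈ S.interiorC) : (φ x)⁻¹ • x ∈ S.Sig φ := by
  have h := hpos.pos_of_mem_interiorC hφ hx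
  exact ⟨S.smul_mem_interiorC hx (inv_pos.2 h), by simp [h.ne']⟩

/-- A ray of `C` in a direction on which a strictly positive functional vanishes has a last
point. -/
theorem StrictlyPos.exists_last (hpos : S.StrictlyPos φ) {x d : X} (hx : x ∈ S.C) (hd : d ≠ 0)
    (hφd : φ d = 0) : ∃ b : ℝ, 0 ≤ b ∧ x + b • d ∈ S.C ∧ ∀ r : ℝ, x + r • d ∈ S.C → r ≤ b := by
  set A : Set ℝ := {r | x + r • d ∈ S.C} with hA
  have h0 : (0 : ℝ) ∈ A := by simpa [hA] using hx
  have hconv : ∀ r ∈ A, ∀ s, 0 ≤ s → s ≤ r → s ∈ A := by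
    intro r hr s hs hsr
    rcases hs.eq_or_lt with rfl | hs
    · exact h0
    have hr0 : 0 < r := hs.trans_le hsr
    have := S.add_mem (S.smul_mem (c := 1 - s / r) (sub_nonneg.2 ((div_le_one hr0).2 hsr)) hx)
      (S.smul_mem (c := s / r) (by positivity) hr)
    change x + s • d ∈ S.C
    convert this using 1
    rw [smul_add, smul_smul, div_mul_cancel₀ _ hr0.ne']
    module
  have hbdd : BddAbove A := by
    by_contra hb
    rw [not_bddAbove_iff] at hb
    have : d ∈ S.C := S.mem_of_forall_nat_smul_add hx fun n _ => by
      obtain ⟨r, hr, hnr⟩ := hb n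
      exact hconv r hr n n.cast_nonneg hnr.le
    exact (hpos d this hd).ne' hφd
  refine ⟨sSup A, le_csSup hbdd h0, ?_, fun r hr => le_csSup hbdd hr⟩
  obtain ⟨c, hc, h1⟩ := S.orderUnit (-d)
  refine S.mem_of_forall_nat_smul_add
    (S.add_mem (S.smul_mem hc.le S.u_mem) (S.smul_mem hc.le S.u_mem)) fun n hn => ?_
  have hn' : (0 : ℝ) < n := by exact_mod_cast hn
  obtain ⟨r, hr, hlt⟩ := exists_lt_of_lt_csSup ⟨0, h0⟩
    (sub_lt_self (sSup A) (one_div_pos.2 hn'))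
  have hle : r ≤ sSup A := le_csSup hbdd hr
  have hk0 : 0 ≤ n * (sSup A - r) := by nlinarith
  have hk1 : n * (sSup A - r) ≤ 1 := by
    have : sSup A - r ≤ 1 / n := by linarith
    calc n * (sSup A - r) ≤ n * (1 / n) := by gcongr
      _ = 1 := by field_simp
  have h2 := S.add_mem (S.smul_mem hn'.le hr) (S.add_mem (S.smul_mem hk0 h1)
    (S.add_mem (S.smul_mem (c := (1 - n * (sSup A - r)) * c) (by nlinarith) S.u_mem)
      (S.smul_mem hc.le S.u_mem)))
  convert h2 using 1
  module

variable (S) in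
/-- The rays through `e₀` and `e₁` are the two extreme rays of the trace of the cone on their
span. -/
def IsQuadrant (e₀ e₁ : X) : Prop :=
  (∀ s t : ℝ, s • e₀ + t • e₁ ∈ S.C ↔ 0 ≤ s ∧ 0 ≤ t) ∧
    ∀ s t : ℝ, s • e₀ + t • e₁ ∈ S.interiorC ↔ 0 < s ∧ 0 < t

theorem IsQuadrant.symm {e₀ e₁ : X} (h : S.IsQuadrant e₀ e₁) : S.IsQuadrant e₁ e₀ :=
  ⟨fun s t => by rw [add_comm, h.1, and_comm], fun s t => by rw [add_comm, h.2, and_comm]⟩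

theorem IsQuadrant.smul_left {e₀ e₁ : X} (h : S.IsQuadrant e₀ e₁) {k : ℝ} (hk : 0 < k) :
    S.IsQuadrant (k • e₀) e₁ :=
  ⟨fun s t => by rw [smul_smul, h.1, mul_nonneg_iff_of_pos_right hk],
    fun s t => by rw [smul_smul, h.2, mul_pos_iff_of_pos_right hk]⟩

theorem IsQuadrant.M_eq {e₀ e₁ : X} (h : S.IsQuadrant e₀ e₁) {s t s' t' : ℝ} (hs : 0 < s)
    (hs' : 0 < s') (ht' : 0 < t') :
    S.M (s • e₀ + t • e₁) (s' • e₀ + t' • e₁) = max (s / s') (t / t') := by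
  have : {c : ℝ | 0 < c ∧ c • (s' • e₀ + t' • e₁) - (s • e₀ + t • e₁) ∈ S.C} =
      Set.Ici (max (s / s') (t / t')) := by
    ext c
    have e : c • (s' • e₀ + t' • e₁) - (s • e₀ + t • e₁) =
      (c * s' - s) • e₀ + (c * t' - t) • e₁ := by module
    simp only [Set.mem_ofPred_eq, e, h.1, sub_nonneg, Set.mem_Ici, max_le_iff, div_le_iff₀ hs',
      div_le_iff₀ ht', and_iff_right_iff_imp, and_imp]
    intro h1 _
    exact pos_of_mul_pos_left (hs.trans_le h1) hs'.le
  rw [M, this, csInf_Ici]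

theorem IsQuadrant.dH_eq {e₀ e₁ : X} (h : S.IsQuadrant e₀ e₁) {s t s' t' : ℝ} (hs : 0 < s)
    (ht : 0 < t) (hs' : 0 < s') (ht' : 0 < t') :
    S.dH (s • e₀ + t • e₁) (s' • e₀ + t' • e₁) =
      |Real.log (s / t) - Real.log (s' / t')| := by
  have key : ∀ {s t s' t' : ℝ}, 0 < s → 0 < t → 0 < s' → 0 < t' → s' / t' ≤ s / t →
      Real.log (max (s / s') (t / t') * max (s' / s) (t' / t)) =
        |Real.log (s / t) - Real.log (s' / t')| := by
    intro s t s' t' hs ht hs' ht' hle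
    rw [div_le_div_iff₀ ht' ht] at hle
    rw [max_eq_left, max_eq_right, abs_of_nonneg, ← Real.log_div (by positivity) (by positivity)]
    · congr 1
      field_simp
    · rw [sub_nonneg]
      refine Real.log_le_log (by positivity) ?_
      rw [div_le_div_iff₀ ht' ht]
      exact hle
    · rw [div_le_div_iff₀ hs ht]
      linarith
    · rw [div_le_div_iff₀ ht' hs']
      linarith
  rw [dH, h.M_eq hs hs' ht', h.M_eq hs' hs ht]
  rcases le_total (s' / t') (s / t) with hle | hle
  · exact key hs ht hs' ht' hle
  · rw [mul_comm, abs_sub_comm]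
    exact key hs' ht' hs ht hle

/-- The chord of a cross section through two of its points. -/
theorem StrictlyPos.exists_isQuadrant (hpos : S.StrictlyPos φ) {x y : X} (hx : x ∈ S.Sig φ)
    (hy : y ∈ S.Sig φ) (hxy : x ≠ y) :
    ∃ a b : ℝ, 0 < a + b ∧ S.IsQuadrant (x - a • (y - x)) (x + b • (y - x)) := by
  have hφ : φ (y - x) = 0 := by simp [hx.2, hy.2]
  have hd : y - x ≠ 0 := sub_ne_zero.2 hxy.symm
  have hxC := S.mem_of_mem_interiorC hx.1
  obtain ⟨b, hb0, hb, hb'⟩ := hpos.exists_last hxC hd hφ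
  obtain ⟨a, ha0, ha, ha'⟩ := hpos.exists_last hxC (neg_ne_zero.2 hd) (by rw [map_neg, hφ, neg_zero])
  have hb1 : 1 ≤ b := hb' 1 (by simpa using S.mem_of_mem_interiorC hy.1)
  have hab : 0 < a + b := by linarith
  have hmem : ∀ s t : ℝ, s • (x - a • (y - x)) + t • (x + b • (y - x)) ∈ S.C ↔
      0 ≤ s ∧ 0 ≤ t := by
    intro s t
    constructor
    · intro h
      have hval : φ (s • (x - a • (y - x)) + t • (x + b • (y - x))) = s + t := by
        simp [hx.2, hy.2]
      by_cases h0 : s • (x - a • (y - x)) + t • (x + b • (y - x)) = 0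
      · rw [h0, map_zero] at hval
        have : (t * (a + b)) • (y - x) = 0 := by
          rw [← h0]
          have : s = -t := by linarith
          subst this
          module
        rcases smul_eq_zero.1 this with h | h
        · have ht : t = 0 := by
            rcases mul_eq_zero.1 h with h | h
            · exact h
            · exact absurd h hab.ne'
          constructor <;> linarith
        · exact absurd h hd
      · have hst : 0 < s + t := hval ▸ hpos _ h h0
        have h1 := S.smul_mem (inv_nonneg.2 hst.le) h
        have e1 : (s + t)⁻¹ • (s • (x - a • (y - x)) + t • (x + b • (y - x))) =
            x + ((s + t)⁻¹ * (t * b - s * a)) • (y - x) := by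
          have : s • (x - a • (y - x)) + t • (x + b • (y - x)) =
            (s + t) • x + (t * b - s * a) • (y - x) := by module
          rw [this, smul_add, smul_smul, inv_mul_cancel₀ hst.ne', one_smul, smul_smul]
        rw [e1] at h1
        have h2 := hb' _ h1
        have h3 := ha' (-((s + t)⁻¹ * (t * b - s * a))) (by
          convert h1 using 1
          module)
        rw [inv_mul_le_iff₀ hst] at h2
        rw [← mul_neg, inv_mul_le_iff₀ hst] at h3
        constructor <;> nlinarith
    · rintro ⟨hs, ht⟩
      refine S.add_mem (S.smul_mem hs ?_) (S.smul_mem ht hb)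
      convert ha using 1
      module
  refine ⟨a, b, hab, hmem, fun s t => ⟨fun h => ?_, ?_⟩⟩
  · obtain ⟨δ, hδ, h1⟩ := S.exists_sub_smul_mem h ((x - a • (y - x)) + (x + b • (y - x)))
    have h2 := (hmem (s - δ) (t - δ)).1 (by
      convert h1 using 1
      module)
    constructor <;> linarith
  · rintro ⟨hs, ht⟩
    set k := min s t / 2 with hk
    have hk0 : 0 < k := by positivity
    have hks : k < s := by linarith [min_le_left s t, lt_min hs ht]
    have hkt : k < t := by linarith [min_le_right s t, lt_min hs ht]
    have hx' : x = (b / (a + b)) • (x - a • (y - x)) + (a / (a + b)) • (x + b • (y - x)) := by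
      match_scalars <;> field_simp <;> ring
    have ha1 : a / (a + b) ≤ 1 := by rw [div_le_one hab]; linarith
    have hb1 : b / (a + b) ≤ 1 := by rw [div_le_one hab]; linarith
    have h1 := S.add_mem_interiorC (S.smul_mem_interiorC hx.1 hk0)
      ((hmem (s - k * (b / (a + b))) (t - k * (a / (a + b)))).2 ⟨by nlinarith, by nlinarith⟩)
    have e := congrArg (k • ·) hx'
    simp only [smul_add, smul_smul] at e
    rw [e] at h1
    convert h1 using 1
    module

end OrderUnitSpace

theorem eq_add_or_eq_sub_of_abs_sub_eq {g : ℝ → ℝ} (hg : ∀ a b, |g a - g b| = |a - b|) :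
    (∀ a, g a = g 0 + a) ∨ ∀ a, g a = g 0 - a := by
  have h0 : ∀ a, g a = g 0 + a ∨ g a = g 0 - a := fun a => by
    have h := hg a 0
    rw [sub_zero, abs_eq_abs] at h
    rcases h with h | h
    · left; linarith
    · right; linarith
  by_contra! hcon
  obtain ⟨⟨a, ha⟩, b, hb⟩ := hcon
  have ha' := (h0 a).resolve_left ha
  have hb' := (h0 b).resolve_right hb
  have h := hg a b
  rw [ha', hb', abs_eq_abs] at h
  rcases h with h | h
  · exact ha (by rw [ha']; linarith)
  · exact hb (by rw [hb']; linarith)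

/-- The extension of a map on the cross section `φ = 1` to a map constant on rays. -/
noncomputable def rayExt {X X' : Type*} [AddCommGroup X] [Module ℝ X] (φ : X →ₗ[ℝ] ℝ)
    (f : X → X') (w : X) : X' :=
  f ((φ w)⁻¹ • w)

theorem rayExt_of_eq_one {X X' : Type*} [AddCommGroup X] [Module ℝ X] {φ : X →ₗ[ℝ] ℝ}
    {f : X → X'} {w : X} (hw : φ w = 1) : rayExt φ f w = f w := by
  simp [rayExt, hw]

theorem rayExt_smul {X X' : Type*} [AddCommGroup X] [Module ℝ X] {φ : X →ₗ[ℝ] ℝ}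
    {f : X → X'} {w : X} {c : ℝ} (hc : c ≠ 0) : rayExt φ f (c • w) = rayExt φ f w := by
  rw [rayExt, rayExt, map_smul, smul_smul, smul_eq_mul, mul_inv, mul_right_comm,
    inv_mul_cancel₀ hc, one_mul]

/-- The coordinates of the points of a chord with respect to its end points. -/
theorem chord_coords {X : Type*} [AddCommGroup X] [Module ℝ X] (x d : X) {a b : ℝ}
    (hab : 0 < a + b) (r : ℝ) :
    x + r • d = ((b - r) / (a + b)) • (x - a • d) + ((a + r) / (a + b)) • (x + b • d) := by
  match_scalars <;> field_simp <;> ring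

theorem OrderUnitSpace.StrictlyPos.eq_of_dH_eq_zero {X : Type*} [AddCommGroup X] [Module ℝ X]
    {S : OrderUnitSpace X} {φ : X →ₗ[ℝ] ℝ} (hpos : S.StrictlyPos φ) {x y : X}
    (hx : x ∈ S.Sig φ) (hy : y ∈ S.Sig φ) (h : S.dH x y = 0) : x = y := by
  by_contra hxy
  obtain ⟨a, b, hab, hq⟩ := hpos.exists_isQuadrant hx hy hxy
  have ex := chord_coords x (y - x) hab 0
  have ey := chord_coords x (y - x) hab 1
  rw [zero_smul, add_zero, sub_zero, add_zero] at ex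
  rw [one_smul, add_sub_cancel] at ey
  have hx' := hx.1
  have hy' := hy.1
  rw [ex, hq.2] at hx'
  rw [ey, hq.2] at hy'
  have h1 : S.dH ((b / (a + b)) • (x - a • (y - x)) + (a / (a + b)) • (x + b • (y - x)))
      (((b - 1) / (a + b)) • (x - a • (y - x)) + ((a + 1) / (a + b)) • (x + b • (y - x))) = 0 := by
    rw [← ex, ← ey, h]
  rw [hq.dH_eq hx'.1 hx'.2 hy'.1 hy'.2, abs_eq_zero, sub_eq_zero] at h1
  have h2 := Real.log_injOn_pos (Set.mem_Ioi.2 (div_pos hx'.1 hx'.2))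
    (Set.mem_Ioi.2 (div_pos hy'.1 hy'.2)) h1
  have ha := (div_pos_iff_of_pos_right hab).1 hx'.2
  have ha1 := (div_pos_iff_of_pos_right hab).1 hy'.2
  rw [div_div_div_cancel_right₀ hab.ne', div_div_div_cancel_right₀ hab.ne',
    div_eq_div_iff ha.ne' ha1.ne'] at h2
  linarith

theorem exists_linearMap_sup_span_singleton {X X' : Type*} [AddCommGroup X] [Module ℝ X]
    [AddCommGroup X'] [Module ℝ X'] {V : Submodule ℝ X} (T : V →ₗ[ℝ] X') {z : X} (hz : z ∉ V)
    (z' : X') :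
    ∃ L : ↥(V ⊔ Submodule.span ℝ ({z} : Set X)) →ₗ[ℝ] X',
      ∀ (w : ↥(V ⊔ Submodule.span ℝ ({z} : Set X))) (y : V) (t : ℝ), (w : X) = y + t • z →
        L w = T y + t • z' := by
  refine ⟨(LinearPMap.supSpanSingleton ⟨V, T⟩ z z' hz).toFun, ?_⟩
  rintro ⟨w, hw⟩ y t rfl
  exact LinearPMap.supSpanSingleton_apply_mk ⟨V, T⟩ z z' hz y y.2 t

section Isometry

variable {X₁ : Type*} [AddCommGroup X₁] [Module ℝ X₁] {X₂ : Type*} [AddCommGroup X₂]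
  [Module ℝ X₂] {S₁ : OrderUnitSpace X₁} {S₂ : OrderUnitSpace X₂} {φ₁ : X₁ →ₗ[ℝ] ℝ}
  {φ₂ : X₂ →ₗ[ℝ] ℝ} {f : X₁ → X₂}

variable (S₁ S₂ φ₁ φ₂ f) in
/-- `f` is an isometry for Hilbert's metric between cross sections given by strictly positive
states, and it maps line segments to line segments. -/
structure IsSegmentIsometry : Prop where
  state₁ : S₁.IsState φ₁
  pos₁ : S₁.StrictlyPos φ₁
  state₂ : S₂.IsState φ₂
  pos₂ : S₂.StrictlyPos φ₂
  mapsTo : Set.MapsTo f (S₁.Sig φ₁) (S₂.Sig φ₂)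
  isometry : ∀ x ∈ S₁.Sig φ₁, ∀ y ∈ S₁.Sig φ₁, S₂.dH (f x) (f y) = S₁.dH x y
  segments : ∀ x ∈ S₁.Sig φ₁, ∀ y ∈ S₁.Sig φ₁, f '' segment ℝ x y = segment ℝ (f x) (f y)

namespace IsSegmentIsometry

theorem rayExt_mem (hf : IsSegmentIsometry S₁ S₂ φ₁ φ₂ f) {w : X₁} (hw : w ∈ S₁.interiorC) :
    rayExt φ₁ f w ∈ S₂.Sig φ₂ :=
  hf.mapsTo (hf.pos₁.normalize_mem_Sig hf.state₁ hw)

theorem injOn (hf : IsSegmentIsometry S₁ S₂ φ₁ φ₂ f) : Set.InjOn f (S₁.Sig φ₁) := by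
  intro x hx y hy h
  by_contra hxy
  refine hxy (hf.pos₁.eq_of_dH_eq_zero hx hy ?_)
  rw [← hf.isometry x hx y hy, h]
  have hM : S₂.M (f y) (f y) = 1 := by
    have hfy := hf.mapsTo hy
    have : {c : ℝ | 0 < c ∧ c • f y - f y ∈ S₂.C} = Set.Ici 1 := by
      ext c
      have e : c • f y - f y = (c - 1) • f y := by module
      rw [Set.mem_ofPred_eq, e, Set.mem_Ici]
      constructor
      · rintro ⟨-, hc⟩
        by_contra! hlt
        have h1 := hf.pos₂.pos_of_mem_interiorC hf.state₂ hfy.1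
        have h2 : 0 < φ₂ ((c - 1) • f y) := hf.pos₂ _ hc
          (smul_ne_zero (by linarith) fun h0 => by simp [h0] at h1)
        rw [map_smul, hfy.2] at h2
        simp only [smul_eq_mul, mul_one] at h2
        linarith
      · exact fun hc => ⟨by linarith, S₂.smul_mem (by linarith) (S₂.mem_of_mem_interiorC hfy.1)⟩
    rw [M, this, csInf_Ici]
  rw [dH, hM]
  simp

theorem map_mem_segment (hf : IsSegmentIsometry S₁ S₂ φ₁ φ₂ f) {x y : X₁} (hx : x ∈ S₁.Sig φ₁)
    (hy : y ∈ S₁.Sig φ₁) {r : ℝ} (hr0 : 0 ≤ r) (hr1 : r ≤ 1) :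
    ∃ ρ : ℝ, f (x + r • (y - x)) = f x + ρ • (f y - f x) := by
  have h1 : x + r • (y - x) ∈ segment ℝ x y := by
    rw [segment_eq_image']
    exact ⟨r, ⟨hr0, hr1⟩, rfl⟩
  have h2 := Set.mem_image_of_mem f h1
  rw [hf.segments x hx y hy, segment_eq_image'] at h2
  obtain ⟨ρ, -, h⟩ := h2
  exact ⟨ρ, h.symm⟩

theorem map_mem_line (hf : IsSegmentIsometry S₁ S₂ φ₁ φ₂ f) {x y : X₁} (hx : x ∈ S₁.Sig φ₁)
    (hy : y ∈ S₁.Sig φ₁) (hxy : x ≠ y) {r : ℝ} (hw : x + r • (y - x) ∈ S₁.Sig φ₁) :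
    ∃ ρ : ℝ, f (x + r • (y - x)) = f x + ρ • (f y - f x) := by
  have hne : f x ≠ f y := fun h => hxy (hf.injOn hx hy h)
  rcases lt_or_ge r 0 with hr0 | hr0
  · obtain ⟨θ, hθ⟩ := hf.map_mem_segment hy hw (r := (1 - r)⁻¹) (by rw [inv_nonneg]; linarith)
      (inv_le_one_of_one_le₀ (by linarith))
    have e : y + (1 - r)⁻¹ • (x + r • (y - x) - y) = x := by
      have : 1 - r ≠ 0 := by linarith
      match_scalars <;> field_simp <;> ring
    rw [e] at hθ
    have hθ0 : θ ≠ 0 := by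
      rintro rfl
      exact hne (by simpa using hθ)
    refine ⟨1 - θ⁻¹, ?_⟩
    rw [hθ]
    match_scalars <;> field_simp <;> ring
  rcases le_or_gt r 1 with hr1 | hr1
  · exact hf.map_mem_segment hx hy hr0 hr1
  · obtain ⟨θ, hθ⟩ := hf.map_mem_segment hx hw (r := r⁻¹) (by positivity)
      (inv_le_one_of_one_le₀ hr1.le)
    have e : x + r⁻¹ • (x + r • (y - x) - x) = y := by
      match_scalars <;> field_simp
      ring
    rw [e] at hθ
    have hθ0 : θ ≠ 0 := by
      rintro rfl
      exact hne (by simpa using hθ.symm)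
    refine ⟨θ⁻¹, ?_⟩
    rw [hθ]
    match_scalars <;> field_simp
    ring

/-- On the chord through two points of its domain, a segment isometry is induced by a linear map
that identifies the two-dimensional cones spanned by the chords. -/
theorem exists_isQuadrant_pair (hf : IsSegmentIsometry S₁ S₂ φ₁ φ₂ f) {x y : X₁}
    (hx : x ∈ S₁.Sig φ₁) (hy : y ∈ S₁.Sig φ₁) (hxy : x ≠ y) :
    ∃ e₀ e₁ : X₁, ∃ E₀ E₁ : X₂, S₁.IsQuadrant e₀ e₁ ∧ S₂.IsQuadrant E₀ E₁ ∧
      (∃ p q : ℝ, x = p • e₀ + q • e₁) ∧ (∃ p q : ℝ, y = p • e₀ + q • e₁) ∧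
      ∀ p q : ℝ, 0 < p → 0 < q →
        ∃ c : ℝ, 0 < c ∧ p • E₀ + q • E₁ = c • rayExt φ₁ f (p • e₀ + q • e₁) := by
  have hne : f x ≠ f y := fun h => hxy (hf.injOn hx hy h)
  obtain ⟨a, b, hab, hq⟩ := hf.pos₁.exists_isQuadrant hx hy hxy
  obtain ⟨A, B, hAB, hQ⟩ := hf.pos₂.exists_isQuadrant (hf.mapsTo hx) (hf.mapsTo hy) hne
  have hcx : ∃ p q : ℝ, x = p • (x - a • (y - x)) + q • (x + b • (y - x)) :=
    ⟨_, _, by simpa using chord_coords x (y - x) hab 0⟩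
  have hcy : ∃ p q : ℝ, y = p • (x - a • (y - x)) + q • (x + b • (y - x)) :=
    ⟨_, _, by simpa using chord_coords x (y - x) hab 1⟩
  have hline : ∀ r : ℝ, x + r • (y - x) ∈ S₁.Sig φ₁ → ∃ P Q : ℝ, 0 < P ∧ 0 < Q ∧
      f (x + r • (y - x)) = P • (f x - A • (f y - f x)) + Q • (f x + B • (f y - f x)) := by
    intro r hr
    obtain ⟨ρ, hρ⟩ := hf.map_mem_line hx hy hxy hr
    have h1 := (hf.mapsTo hr).1
    rw [chord_coords (f x) (f y - f x) hAB ρ] at hρ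
    rw [hρ, hQ.2] at h1
    exact ⟨_, _, h1.1, h1.2, hρ⟩
  have hchord : ∀ τ : ℝ,
      (φ₁ (Real.exp τ • (x - a • (y - x)) + (x + b • (y - x))))⁻¹ •
        (Real.exp τ • (x - a • (y - x)) + (x + b • (y - x))) =
          x + ((b - a * Real.exp τ) / (Real.exp τ + 1)) • (y - x) := by
    intro τ
    have h1 : φ₁ (Real.exp τ • (x - a • (y - x)) + (x + b • (y - x))) = Real.exp τ + 1 := by
      simp [hx.2, hy.2]
    have h2 : Real.exp τ + 1 ≠ 0 := by positivity
    rw [h1]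
    match_scalars <;> field_simp <;> ring
  generalize hE₀ : f x - A • (f y - f x) = E₀ at hQ hline
  generalize hE₁ : f x + B • (f y - f x) = E₁ at hQ hline
  generalize he₀ : x - a • (y - x) = e₀ at hq hcx hcy hchord
  generalize he₁ : x + b • (y - x) = e₁ at hq hcx hcy hchord
  have hint : ∀ τ : ℝ, Real.exp τ • e₀ + e₁ ∈ S₁.interiorC := fun τ => by
    simpa using (hq.2 (Real.exp τ) 1).2 ⟨Real.exp_pos τ, one_pos⟩
  have hpar : ∀ τ : ℝ, ∃ P Q : ℝ, 0 < P ∧ 0 < Q ∧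
      rayExt φ₁ f (Real.exp τ • e₀ + e₁) = P • E₀ + Q • E₁ := fun τ => by
    have h1 := hf.pos₁.normalize_mem_Sig hf.state₁ (hint τ)
    rw [hchord] at h1
    rw [rayExt, hchord]
    exact hline _ h1
  choose P Q hP hQ0 hPQ using hpar
  have hg : ∀ s t : ℝ, |Real.log (P s / Q s) - Real.log (P t / Q t)| = |s - t| := by
    intro s t
    have h1 := hf.isometry _ (hf.pos₁.normalize_mem_Sig hf.state₁ (hint s)) _
      (hf.pos₁.normalize_mem_Sig hf.state₁ (hint t))
    change S₂.dH (rayExt φ₁ f _) (rayExt φ₁ f _) = _ at h1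
    rw [hPQ, hPQ, hQ.dH_eq (hP s) (hQ0 s) (hP t) (hQ0 t)] at h1
    have hc := fun τ => inv_pos.2 (hf.pos₁.pos_of_mem_interiorC hf.state₁ (hint τ))
    rw [h1, smul_add, smul_smul, smul_add, smul_smul, hq.dH_eq
      (mul_pos (hc s) (Real.exp_pos s)) (hc s) (mul_pos (hc t) (Real.exp_pos t)) (hc t),
      mul_div_cancel_left₀ _ (hc s).ne', mul_div_cancel_left₀ _ (hc t).ne', Real.log_exp,
      Real.log_exp]
  have hfin : ∀ E₀' E₁' : X₂,
      (∀ τ : ℝ, ∃ c : ℝ, 0 < c ∧ Real.exp τ • E₀' + E₁' = c • rayExt φ₁ f (Real.exp τ • e₀ + e₁)) →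
      ∀ p q : ℝ, 0 < p → 0 < q →
        ∃ c : ℝ, 0 < c ∧ p • E₀' + q • E₁' = c • rayExt φ₁ f (p • e₀ + q • e₁) := by
    intro E₀' E₁' h p q hp hq
    obtain ⟨c, hc, h⟩ := h (Real.log (p / q))
    rw [Real.exp_log (by positivity)] at h
    have e : p • e₀ + q • e₁ = q • ((p / q) • e₀ + e₁) := by
      match_scalars <;> field_simp
    refine ⟨q * c, by positivity, ?_⟩
    rw [e, rayExt_smul hq.ne', mul_smul, ← h]
    match_scalars <;> field_simp
  have hlog : ∀ τ σ : ℝ, Real.log (P τ / Q τ) = σ → P τ = Real.exp σ * Q τ := by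
    rintro τ σ rfl
    rw [Real.exp_log (div_pos (hP τ) (hQ0 τ)), div_mul_cancel₀ _ (hQ0 τ).ne']
  rcases eq_add_or_eq_sub_of_abs_sub_eq hg with h | h
  · refine ⟨e₀, e₁, Real.exp (Real.log (P 0 / Q 0)) • E₀, E₁, hq, hQ.smul_left (Real.exp_pos _),
      hcx, hcy, hfin _ _ fun τ => ⟨(Q τ)⁻¹, inv_pos.2 (hQ0 τ), ?_⟩⟩
    have h1 := hlog _ _ (h τ)
    have h2 := (hQ0 τ).ne'
    rw [hPQ, h1, Real.exp_add]
    match_scalars <;> field_simp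
  · refine ⟨e₀, e₁, Real.exp (-Real.log (P 0 / Q 0)) • E₁, E₀, hq,
      hQ.symm.smul_left (Real.exp_pos _), hcx, hcy, hfin _ _ fun τ => ⟨(P τ)⁻¹,
        inv_pos.2 (hP τ), ?_⟩⟩
    have h1 := hlog _ _ (h τ)
    have h2 := (hQ0 τ).ne'
    have h3 := (hP τ).ne'
    rw [hPQ]
    match_scalars
    · rw [h1, Real.exp_sub, Real.exp_neg]
      field_simp
    · field_simp

end IsSegmentIsometry

variable (S₁ S₂ φ₁ f) in
/-- The linear map sending `x` to `X` and `y` to `Y` is bi-positive on the span of `x` and `y`, and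
it induces `f` there. -/
def IsPlaneLift (x y : X₁) (X Y : X₂) : Prop :=
  ∀ s t : ℝ, (s • X + t • Y ∈ S₂.C ↔ s • x + t • y ∈ S₁.C) ∧
    (s • x + t • y ∈ S₁.interiorC → ∃ c : ℝ, 0 < c ∧ s • X + t • Y = c • rayExt φ₁ f (s • x + t • y))

theorem IsPlaneLift.linearIndependent {x y : X₁} {X Y : X₂} (h : IsPlaneLift S₁ S₂ φ₁ f x y X Y)
    (hxy : LinearIndependent ℝ ![x, y]) : LinearIndependent ℝ ![X, Y] := by
  rw [LinearIndependent.pair_iff] at hxy ⊢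
  intro s t hst
  refine hxy s t (S₁.salient ((h s t).1.1 (hst ▸ S₂.zero_mem)) ?_)
  have h1 : (-s) • X + (-t) • Y = 0 := by
    rw [neg_smul, neg_smul, ← neg_add, hst, neg_zero]
  have h2 := (h (-s) (-t)).1.1 (h1 ▸ S₂.zero_mem)
  rwa [neg_smul, neg_smul, ← neg_add] at h2

theorem IsSegmentIsometry.exists_isPlaneLift (hf : IsSegmentIsometry S₁ S₂ φ₁ φ₂ f) {x y : X₁}
    (hx : x ∈ S₁.interiorC) (hy : y ∈ S₁.interiorC) (hxy : LinearIndependent ℝ ![x, y]) {a : ℝ}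
    (ha : 0 < a) :
    ∃ b : ℝ, 0 < b ∧ IsPlaneLift S₁ S₂ φ₁ f x y (a • rayExt φ₁ f x) (b • rayExt φ₁ f y) := by
  have hpx := hf.pos₁.pos_of_mem_interiorC hf.state₁ hx
  have hpy := hf.pos₁.pos_of_mem_interiorC hf.state₁ hy
  have hne : (φ₁ x)⁻¹ • x ≠ (φ₁ y)⁻¹ • y := by
    intro h
    have := (LinearIndependent.pair_iff.1 hxy (φ₁ x)⁻¹ (-(φ₁ y)⁻¹)
      (by rw [h, neg_smul, add_neg_cancel])).1
    exact (inv_pos.2 hpx).ne' this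
  obtain ⟨e₀, e₁, E₀, E₁, hq, hQ, ⟨p, q, hpq⟩, ⟨p', q', hpq'⟩, hrep⟩ :=
    hf.exists_isQuadrant_pair (hf.pos₁.normalize_mem_Sig hf.state₁ hx)
      (hf.pos₁.normalize_mem_Sig hf.state₁ hy) hne
  rw [inv_smul_eq_iff₀ hpx.ne', smul_add, smul_smul, smul_smul] at hpq
  rw [inv_smul_eq_iff₀ hpy.ne', smul_add, smul_smul, smul_smul] at hpq'
  generalize φ₁ x * p = p at hpq
  generalize φ₁ x * q = q at hpq
  generalize φ₁ y * p' = p' at hpq'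
  generalize φ₁ y * q' = q' at hpq'
  rw [hpq, hq.2] at hx
  rw [hpq', hq.2] at hy
  obtain ⟨c, hc, hX⟩ := hrep p q hx.1 hx.2
  obtain ⟨d, hd, hY⟩ := hrep p' q' hy.1 hy.2
  rw [← hpq] at hX
  rw [← hpq'] at hY
  refine ⟨a / c * d, by positivity, fun s t => ?_⟩
  have e : s • a • rayExt φ₁ f x + t • (a / c * d) • rayExt φ₁ f y =
      (a / c) • ((s * p + t * p') • E₀ + (s * q + t * q') • E₁) := by
    have h1 : a • rayExt φ₁ f x = (a / c) • c • rayExt φ₁ f x := by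
      rw [smul_smul, div_mul_cancel₀ _ hc.ne']
    rw [h1, mul_smul, ← hX, ← hY]
    module
  have e' : s • x + t • y = (s * p + t * p') • e₀ + (s * q + t * q') • e₁ := by
    rw [hpq, hpq']
    module
  rw [e, e', S₂.smul_mem_iff (div_pos ha hc), hq.1, hQ.1, hq.2]
  refine ⟨Iff.rfl, fun h => ?_⟩
  obtain ⟨k, hk, h⟩ := hrep _ _ h.1 h.2
  exact ⟨a / c * k, by positivity, by rw [h, smul_smul]⟩

/-- A linear map that induces `f` at one point and along the end of a ray in its direction
induces `f` on the whole plane. -/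
theorem IsSegmentIsometry.isPlaneLift_of_eventually (hf : IsSegmentIsometry S₁ S₂ φ₁ φ₂ f)
    {x y : X₁} (hx : x ∈ S₁.interiorC) (hy : y ∈ S₁.interiorC)
    (hxy : LinearIndependent ℝ ![x, y]) {a : ℝ} (ha : 0 < a) {Y : X₂} {N₀ : ℝ}
    (h : ∀ N ≥ N₀, ∃ c : ℝ, 0 < c ∧ N • a • rayExt φ₁ f x + Y = c • rayExt φ₁ f (N • x + y)) :
    IsPlaneLift S₁ S₂ φ₁ f x y (a • rayExt φ₁ f x) Y := by
  obtain ⟨b, hb, hl⟩ := hf.exists_isPlaneLift hx hy hxy ha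
  have hind := LinearIndependent.pair_iff.1 (hl.linearIndependent hxy)
  generalize a • rayExt φ₁ f x = X at *
  generalize b • rayExt φ₁ f y = Z at *
  have hprop : ∀ N ≥ max N₀ 1, ∃ ρ : ℝ, N • X + Y = ρ • (N • X + Z) := by
    intro N hN
    have hN0 : 0 < N := one_pos.trans_le ((le_max_right _ _).trans hN)
    obtain ⟨c, hc, h1⟩ := h N ((le_max_left _ _).trans hN)
    obtain ⟨d, hd, h2⟩ := (hl N 1).2 (by
      rw [one_smul]
      exact S₁.add_mem_interiorC (S₁.smul_mem_interiorC hx hN0) (S₁.mem_of_mem_interiorC hy))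
    rw [one_smul, one_smul] at h2
    exact ⟨c / d, by rw [h1, h2, smul_smul, div_mul_cancel₀ _ hd.ne']⟩
  set N := max N₀ 1
  obtain ⟨ρ, hρ⟩ := hprop N le_rfl
  obtain ⟨σ, hσ⟩ := hprop (N + 1) (by linarith)
  have h0 : (1 + ρ * N - σ * (N + 1)) • X + (ρ - σ) • Z = 0 := by
    linear_combination (norm := module) hσ - hρ
  obtain ⟨h1, h2⟩ := hind _ _ h0
  have hρσ : ρ = σ := sub_eq_zero.1 h2
  subst hρσ
  have hρ1 : ρ = 1 := by linarith
  have hYZ : Y = Z := by simpa [hρ1] using hρ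
  rwa [hYZ]

variable (S₁ S₂ φ₁ f) in
/-- A bi-positive linear map on a subspace that induces `f`. -/
structure IsPartialLift (V : Submodule ℝ X₁) (T : V →ₗ[ℝ] X₂) : Prop where
  mem_iff : ∀ y : V, T y ∈ S₂.C ↔ (y : X₁) ∈ S₁.C
  rep : ∀ y : V, (y : X₁) ∈ S₁.interiorC → ∃ c : ℝ, 0 < c ∧ T y = c • rayExt φ₁ f y

namespace IsPartialLift

variable {V : Submodule ℝ X₁} {T : V →ₗ[ℝ] X₂}

theorem eq_zero (hT : IsPartialLift S₁ S₂ φ₁ f V T) {y : V} (hy : T y = 0) : y = 0 := by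
  refine Subtype.ext (S₁.salient ((hT.mem_iff y).1 (hy ▸ S₂.zero_mem)) ?_)
  have h1 : T (-y) = 0 := by rw [map_neg, hy, neg_zero]
  exact (hT.mem_iff (-y)).1 (h1 ▸ S₂.zero_mem)

/-- The image of a point outside the domain is independent of the range. -/
theorem eq_zero_of_add_smul_eq_zero (hT : IsPartialLift S₁ S₂ φ₁ f V T)
    (hf : IsSegmentIsometry S₁ S₂ φ₁ φ₂ f) {y₀ : V} (hy₀ : (y₀ : X₁) ∈ S₁.interiorC) {z : X₁}
    (hz : z ∈ S₁.Sig φ₁) (hzV : z ∉ V) {y : V} {t : ℝ} (h : T y + t • f z = 0) : t = 0 := by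
  by_contra ht
  obtain ⟨y', hy'⟩ : ∃ y' : V, T y' = f z := by
    refine ⟨-t⁻¹ • y, ?_⟩
    rw [map_smul, eq_neg_of_add_eq_zero_left h, smul_neg, neg_smul, neg_neg, smul_smul,
      inv_mul_cancel₀ ht, one_smul]
  have hfz := hf.mapsTo hz
  obtain ⟨δ, hδ, h1⟩ := S₂.exists_sub_smul_mem hfz.1 (T y₀)
  rw [← hy', ← map_smul, ← map_sub, hT.mem_iff] at h1
  have hint : (y' : X₁) ∈ S₁.interiorC := by
    convert S₁.add_mem_interiorC (S₁.smul_mem_interiorC hy₀ hδ) h1 using 1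
    simp
  obtain ⟨c, hc, h2⟩ := hT.rep y' hint
  have hc1 : c = 1 := by
    have h3 := congrArg φ₂ h2
    rw [hy', hfz.2, map_smul, (hf.rayExt_mem hint).2, smul_eq_mul, mul_one] at h3
    exact h3.symm
  rw [hc1, one_smul, hy', rayExt] at h2
  have h4 := hf.injOn hz (hf.pos₁.normalize_mem_Sig hf.state₁ hint) h2
  exact hzV (h4 ▸ V.smul_mem _ y'.2)

theorem linearIndependent_coe {V : Submodule ℝ X₁} {y : V} (hy : y ≠ 0) {w z : X₁} (hzV : z ∉ V)
    {r : ℝ} (hr : r ≠ 0) (hw : w - r • z ∈ V) : LinearIndependent ℝ ![(y : X₁), w] := by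
  rw [LinearIndependent.pair_iff]
  intro s t h
  have ht : t = 0 := by
    by_contra ht
    refine hzV ?_
    have h1 : z = -(t * r)⁻¹ • (s • (y : X₁) + t • (w - r • z)) := by
      rw [smul_sub, ← add_sub_assoc, h, zero_sub, smul_neg, neg_smul, neg_neg, smul_smul,
        smul_smul, mul_assoc, inv_mul_cancel₀ (mul_ne_zero ht hr), one_smul]
    rw [h1]
    exact V.smul_mem _ (V.add_mem (V.smul_mem _ y.2) (V.smul_mem _ hw))
  rw [ht, zero_smul, add_zero] at h
  exact ⟨(smul_eq_zero.1 h).resolve_right fun h0 => hy (Subtype.ext h0), ht⟩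

theorem scale_eq_scale_add (hT : IsPartialLift S₁ S₂ φ₁ f V T)
    (hf : IsSegmentIsometry S₁ S₂ φ₁ φ₂ f) {z : X₁} (hz : z ∈ S₁.Sig φ₁) (hzV : z ∉ V)
    {y y' : V} (hy : (y : X₁) ∈ S₁.interiorC) (hy' : (y' : X₁) ∈ S₁.interiorC)
    (hyy' : LinearIndependent ℝ ![y, y']) {α β : ℝ}
    (hα : IsPlaneLift S₁ S₂ φ₁ f y z (T y) (α • f z))
    (hβ : IsPlaneLift S₁ S₂ φ₁ f (y' + y : V) z (T (y' + y)) (β • f z)) : α = β := by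
  have hyz : (y : X₁) + z ∈ S₁.interiorC :=
    S₁.add_mem_interiorC hy (S₁.mem_of_mem_interiorC hz.1)
  have hy'0 : y' ≠ 0 := hyy'.ne_zero 1
  obtain ⟨a, ha, hTy'⟩ := hT.rep y' hy'
  obtain ⟨b, hb, hl⟩ := hf.exists_isPlaneLift hy' hyz
    (linearIndependent_coe hy'0 hzV one_ne_zero (by simp)) ha
  obtain ⟨c, hc, h1⟩ := (hα 1 1).2 (by simpa using hyz)
  have hyyz : (y' : X₁) + (y + z) ∈ S₁.interiorC :=
    S₁.add_mem_interiorC hy' (S₁.mem_of_mem_interiorC hyz)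
  obtain ⟨d, hd, h2⟩ := (hl 1 1).2 (by simpa using hyyz)
  obtain ⟨k, hk, h3⟩ := (hβ 1 1).2 (by simpa [add_assoc] using hyyz)
  rw [← hTy'] at h2
  simp only [one_smul, Submodule.coe_add, add_assoc] at h1 h2 h3
  have h4 : rayExt φ₁ f ((y : X₁) + z) = c⁻¹ • (T y + α • f z) := by
    rw [h1, smul_smul, inv_mul_cancel₀ hc.ne', one_smul]
  have h5 : rayExt φ₁ f ((y' : X₁) + (y + z)) = k⁻¹ • (T (y' + y) + β • f z) := by
    rw [h3, smul_smul, inv_mul_cancel₀ hk.ne', one_smul]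
  rw [h4, h5] at h2
  have h6 : T ((1 - d / k) • y' + (b / c - d / k) • y) + (b / c * α - d / k * β) • f z = 0 := by
    rw [map_add, map_smul, map_smul]
    rw [map_add] at h2
    linear_combination (norm := module) h2
  have h7 := hT.eq_zero_of_add_smul_eq_zero hf hy hz hzV h6
  rw [h7, zero_smul, add_zero] at h6
  have h8 := hT.eq_zero h6
  rw [add_comm] at h8
  obtain ⟨h9, h10⟩ := LinearIndependent.pair_iff.1 hyy' _ _ h8
  have h11 : d / k = 1 := by linarith
  have h12 : b / c = 1 := by linarith
  rw [h11, h12] at h7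
  linarith

/-- The scaling of the image of `z` does not depend on the plane through `z`. -/
theorem exists_scale (hT : IsPartialLift S₁ S₂ φ₁ f V T)
    (hf : IsSegmentIsometry S₁ S₂ φ₁ φ₂ f) {z : X₁} (hz : z ∈ S₁.Sig φ₁) (hzV : z ∉ V)
    {y₀ : V} (hy₀ : (y₀ : X₁) ∈ S₁.interiorC) :
    ∃ α : ℝ, ∀ y : V, (y : X₁) ∈ S₁.interiorC →
      IsPlaneLift S₁ S₂ φ₁ f y z (T y) (α • f z) := by
  have hlift : ∀ y : V, (y : X₁) ∈ S₁.interiorC →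
      ∃ α : ℝ, IsPlaneLift S₁ S₂ φ₁ f y z (T y) (α • f z) := by
    intro y hy
    have hy0 : y ≠ 0 := by
      rintro rfl
      exact zero_notMem_interiorC hf.state₁ hy
    obtain ⟨a, ha, h⟩ := hT.rep y hy
    obtain ⟨b, -, hb⟩ := hf.exists_isPlaneLift hy hz.1
      (linearIndependent_coe hy0 hzV one_ne_zero (by simp)) ha
    rw [← h, rayExt_of_eq_one hz.2] at hb
    exact ⟨b, hb⟩
  obtain ⟨α, hα⟩ := hlift y₀ hy₀
  refine ⟨α, fun y hy => ?_⟩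
  by_cases hind : LinearIndependent ℝ ![y₀, y]
  · obtain ⟨β, hβ⟩ := hlift y hy
    obtain ⟨γ, hγ⟩ := hlift (y + y₀)
      (S₁.add_mem_interiorC hy (S₁.mem_of_mem_interiorC hy₀))
    have h1 := hT.scale_eq_scale_add hf hz hzV hy₀ hy hind hα hγ
    have h2 := hT.scale_eq_scale_add hf hz hzV hy hy₀ (LinearIndependent.pair_symm_iff.1 hind) hβ
      (by rwa [add_comm y₀ y])
    rwa [h1, ← h2]
  · have hy₀0 : y₀ ≠ 0 := by
      rintro rfl
      exact zero_notMem_interiorC hf.state₁ hy₀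
    rw [LinearIndependent.pair_iff' hy₀0] at hind
    push Not at hind
    obtain ⟨k, rfl⟩ := hind
    intro s t
    simpa [smul_smul] using hα (s * k) t

end IsPartialLift

end Isometry

/-- Let `f : (Σ₁, d_H) → (Σ₂, d_H)` be an isometry mapping line
segments to line segments, let `Y ⊆ X₁` be a subspace with `Y ∩ Σ₁ ≠ ∅`, and let
`T : Y → X₂` be a bi-positive linear map with `[T y] = f y` for all `y ∈ Y ∩ Σ₁`.
Then for every `z ∈ Σ₁ \ Y` there is a bi-positive linear extension
`T̂ : Y ⊕ Span{z} → X₂` of `T` with `[T̂ y] = f y` for all `y ∈ (Y ⊕ Span{z}) ∩ Σ₁`. -/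
theorem bipositive_extension_to_span
    {X₁ : Type*} [AddCommGroup X₁] [Module ℝ X₁]
    {X₂ : Type*} [AddCommGroup X₂] [Module ℝ X₂]
    (S₁ : OrderUnitSpace X₁) (S₂ : OrderUnitSpace X₂)
    (φ₁ : X₁ →ₗ[ℝ] ℝ) (φ₂ : X₂ →ₗ[ℝ] ℝ)
    (hstate₁ : S₁.IsState φ₁) (hpos₁ : S₁.StrictlyPos φ₁)
    (hstate₂ : S₂.IsState φ₂) (hpos₂ : S₂.StrictlyPos φ₂)
    (f : X₁ → X₂) (hmaps : Set.MapsTo f (S₁.Sig φ₁) (S₂.Sig φ₂))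
    (hiso : ∀ x ∈ S₁.Sig φ₁, ∀ y ∈ S₁.Sig φ₁, S₂.dH (f x) (f y) = S₁.dH x y)
    (hseg : ∀ x ∈ S₁.Sig φ₁, ∀ y ∈ S₁.Sig φ₁,
      f '' segment ℝ x y = segment ℝ (f x) (f y))
    (Y : Submodule ℝ X₁) (hY : ((Y : Set X₁) ∩ S₁.Sig φ₁).Nonempty)
    (T : Y →ₗ[ℝ] X₂)
    (hbipos : ∀ y : Y, T y ∈ S₂.C ↔ (y : X₁) ∈ S₁.C)
    (hTf : ∀ y : Y, (y : X₁) ∈ S₁.Sig φ₁ → (φ₂ (T y))⁻¹ • T y = f y)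
    (z : X₁) (hz : z ∈ S₁.Sig φ₁) (hzY : z ∉ Y) :
    ∃ That : ↥(Y ⊔ Submodule.span ℝ ({z} : Set X₁)) →ₗ[ℝ] X₂,
      (∀ y : Y, That (Submodule.inclusion le_sup_left y) = T y) ∧
      (∀ w : ↥(Y ⊔ Submodule.span ℝ ({z} : Set X₁)),
        That w ∈ S₂.C ↔ (w : X₁) ∈ S₁.C) ∧
      (∀ w : ↥(Y ⊔ Submodule.span ℝ ({z} : Set X₁)),
        (w : X₁) ∈ S₁.Sig φ₁ → (φ₂ (That w))⁻¹ • That w = f w) := by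
  have hf : IsSegmentIsometry S₁ S₂ φ₁ φ₂ f :=
    ⟨hstate₁, hpos₁, hstate₂, hpos₂, hmaps, hiso, hseg⟩
  have hT : IsPartialLift S₁ S₂ φ₁ f Y T := by
    refine ⟨hbipos, fun y hy => ?_⟩
    have hy' := hpos₁.normalize_mem_Sig hstate₁ hy
    have h1 := hTf ((φ₁ y)⁻¹ • y) hy'
    have h2 : φ₂ (T y) ≠ 0 := by
      intro h0
      have h3 := (hmaps hy').2
      rw [Submodule.coe_smul, map_smul, map_smul, h0, smul_zero, inv_zero, zero_smul] at h1
      rw [← h1, map_zero] at h3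
      exact zero_ne_one h3
    have h3 := hpos₂ _ ((hbipos y).2 (S₁.mem_of_mem_interiorC hy)) fun h0 => h2 (by simp [h0])
    refine ⟨φ₂ (T y), h3, ?_⟩
    have h4 := (hpos₁.pos_of_mem_interiorC hstate₁ hy).ne'
    rw [rayExt, ← Submodule.coe_smul, ← h1, map_smul, map_smul, smul_smul, smul_smul, smul_eq_mul,
      mul_inv, inv_inv]
    match_scalars
    field_simp
  obtain ⟨x₀, hx₀Y, hx₀⟩ := hY
  obtain ⟨y₀, rfl⟩ : ∃ y₀ : Y, (y₀ : X₁) = x₀ := ⟨⟨x₀, hx₀Y⟩, rfl⟩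
  have hy₀0 : y₀ ≠ 0 := by
    rintro rfl
    exact zero_notMem_interiorC hstate₁ hx₀.1
  obtain ⟨a, ha, hTy₀⟩ := hT.rep y₀ hx₀.1
  obtain ⟨α, hα⟩ := hT.exists_scale hf hz hzY hx₀.1
  obtain ⟨That, hThat⟩ := exists_linearMap_sup_span_singleton T hzY (α • f z)
  have hY' : ∀ y : Y, That (Submodule.inclusion le_sup_left y) = T y := fun y => by
    rw [hThat _ y 0 (by simp), zero_smul, add_zero]
  have key : ∀ w : ↥(Y ⊔ Submodule.span ℝ ({z} : Set X₁)),
      (That w ∈ S₂.C ↔ (w : X₁) ∈ S₁.C) ∧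
        ((w : X₁) ∈ S₁.interiorC → ∃ c : ℝ, 0 < c ∧ That w = c • rayExt φ₁ f w) := by
    intro w
    obtain ⟨y, t, hw⟩ : ∃ (y : Y) (t : ℝ), (w : X₁) = y + t • z := by
      obtain ⟨y, hy, v, hv, hw⟩ := Submodule.mem_sup.1 w.2
      obtain ⟨t, rfl⟩ := Submodule.mem_span_singleton.1 hv
      exact ⟨⟨y, hy⟩, t, hw.symm⟩
    have hThatw := hThat w y t hw
    generalize That w = W at hThatw ⊢
    generalize (w : X₁) = v at hw ⊢
    by_cases ht : t = 0
    · rw [ht, zero_smul, add_zero] at hw hThatw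
      rw [hThatw, hw]
      exact ⟨hbipos y, hT.rep y⟩
    obtain ⟨s, -, hs⟩ := S₁.exists_smul_add_mem_interiorC hx₀.1 v
    obtain ⟨N, -, hN⟩ := S₁.exists_smul_add_mem_interiorC hx₀.1 (y : X₁)
    have hlift : IsPlaneLift S₁ S₂ φ₁ f y₀ (s • (y₀ : X₁) + v) (T y₀) (s • T y₀ + W) := by
      rw [hTy₀]
      refine hf.isPlaneLift_of_eventually (N₀ := max 0 (N - s)) hx₀.1 (hs s le_rfl)
        (IsPartialLift.linearIndependent_coe hy₀0 hzY ht ?_) ha fun M hM => ?_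
      · rw [hw, ← add_assoc, add_sub_cancel_right]
        exact Y.add_mem (Y.smul_mem _ y₀.2) y.2
      · have hM0 : 0 ≤ M := (le_max_left _ _).trans hM
        have hMs : N ≤ M + s := by linarith [(le_max_right _ _).trans hM]
        obtain ⟨v', hv', hTv'⟩ : ∃ v' : Y, (v' : X₁) = (M + s) • (y₀ : X₁) + y ∧
            T v' = (M + s) • T y₀ + T y :=
          ⟨(M + s) • y₀ + y, rfl, by rw [map_add, map_smul]⟩
        have e : (1 : ℝ) • (v' : X₁) + t • z = M • (y₀ : X₁) + (s • (y₀ : X₁) + v) := by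
          rw [hw, hv']
          module
        have h1 := (hα v' (hv' ▸ hN _ hMs) 1 t).2
        rw [e] at h1
        obtain ⟨c, hc, h⟩ := h1 (by
          rw [← add_assoc, ← add_smul]
          exact hs _ (by linarith))
        refine ⟨c, hc, ?_⟩
        rw [← h, hThatw, ← hTy₀, hTv']
        module
    have h1 := hlift (-s) 1
    have e1 : (-s) • T y₀ + (1 : ℝ) • (s • T y₀ + W) = W := by module
    have e2 : (-s) • (y₀ : X₁) + (1 : ℝ) • (s • (y₀ : X₁) + v) = v := by module
    rwa [e1, e2] at h1
  refine ⟨That, hY', fun w => (key w).1, fun w hw => ?_⟩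
  obtain ⟨c, hc, h⟩ := (key w).2 hw.1
  rw [rayExt_of_eq_one hw.2] at h
  rw [h, map_smul, (hmaps hw).2, smul_eq_mul, mul_one, smul_smul, inv_mul_cancel₀ hc.ne', one_smul]

end HilbertGeom
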